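/- arXiv:1810.00963 — 4 statements merged into one kernel-verified Lean document; each statement's English description precedes it below -/
import Mathlib

section
/- Let 1 ≤ p < q < ∞ and d ≥ 1. Define f(x) := |x|^{−d/q}, g(x) := χ_{(0,1)}(|x|) f(x), and k(x) := −f(x) + 2g(x) for x ∈ ℝ^d. Then ‖f+k‖²_{M^p_q} + ‖f−k‖²_{M^p_q} = 4(‖f‖²_{M^p_q} + ‖k‖²_{M^p_q}). -/
open MeasureTheory
open scoped ENNReal

/-- The Morrey norm `‖f‖_{M^p_q}` of a (measurable) function on `ℝ^d`:
the supremum over all balls `B = B(a,r)` of `|B|^(1/q - 1/p) (∫_B |f|^p)^(1/p)`. -/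
noncomputable def morreyNorm (p q : ℝ) (d : ℕ) (f : EuclideanSpace ℝ (Fin d) → ℝ) : ℝ≥0∞ :=
  ⨆ (a : EuclideanSpace ℝ (Fin d)) (r : ℝ) (_ : 0 < r),
    volume (Metric.ball a r) ^ ((1:ℝ)/q - 1/p) *
      (∫⁻ y in Metric.ball a r, ENNReal.ofReal (|f y| ^ p)) ^ ((1:ℝ)/p)

open Filter Topology in
/-- Fatou property of the Morrey norm. -/
theorem morreyNorm_le_of_eventually_eq {p q : ℝ} {d : ℕ} (hp : 0 < p)
    {φ : EuclideanSpace ℝ (Fin d) → ℝ} {u : ℕ → EuclideanSpace ℝ (Fin d) → ℝ} {M : ℝ≥0∞}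
    (hu : ∀ n, Measurable (u n)) (hlim : ∀ x, ∀ᶠ n in atTop, u n x = φ x)
    (hM : ∀ n, morreyNorm p q d (u n) ≤ M) : morreyNorm p q d φ ≤ M := by
  refine iSup_le fun a => iSup_le fun r => iSup_le fun hr => ?_
  set c := volume (Metric.ball a r) ^ ((1:ℝ)/q - 1/p)
  have hv0 : volume (Metric.ball a r) ≠ 0 := (Metric.measure_ball_pos volume a hr).ne'
  have hvt : volume (Metric.ball a r) ≠ ∞ := measure_ball_lt_top.ne
  have hc0 : c ≠ 0 := (ENNReal.rpow_pos (pos_iff_ne_zero.2 hv0) hvt).ne'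
  have hct : c ≠ ∞ := ENNReal.rpow_ne_top_of_ne_zero hv0 hvt
  have key : ∀ I : ℝ≥0∞, c * I ^ (1 / p) ≤ M ↔ I ≤ (M / c) ^ p := fun I => by
    rw [mul_comm, ← ENNReal.le_div_iff_mul_le (Or.inl hc0) (Or.inl hct), one_div,
      ENNReal.rpow_inv_le_iff hp]
  rw [key]
  have hn : ∀ n, ∫⁻ y in Metric.ball a r, ENNReal.ofReal (|u n y| ^ p) ≤ (M / c) ^ p := fun n =>
    (key _).1 <| (hM n).trans' <| le_iSup_of_le a <| le_iSup_of_le r <|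
      le_iSup_of_le (ι := 0 < r) hr le_rfl
  calc ∫⁻ y in Metric.ball a r, ENNReal.ofReal (|φ y| ^ p)
      ≤ ∫⁻ y in Metric.ball a r, liminf (fun n => ENNReal.ofReal (|u n y| ^ p)) atTop := by
        refine lintegral_mono fun y => ?_
        refine le_liminf_of_le (by isBoundedDefault) ?_
        filter_upwards [hlim y] with n h
        rw [h]
    _ ≤ liminf (fun n => ∫⁻ y in Metric.ball a r, ENNReal.ofReal (|u n y| ^ p)) atTop :=
        lintegral_liminf_le fun n => by
          have := hu n
          fun_prop
    _ ≤ (M / c) ^ p := by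
        refine le_trans (liminf_le_liminf (v := fun _ => (M / c) ^ p)
          (Eventually.of_forall hn)) ?_
        simp

theorem morreyNorm_mono {p q : ℝ} {d : ℕ} (hp : 0 < p)
    {φ ψ : EuclideanSpace ℝ (Fin d) → ℝ} (h : ∀ x, |φ x| ≤ |ψ x|) :
    morreyNorm p q d φ ≤ morreyNorm p q d ψ := by
  refine iSup_mono fun a => iSup_mono fun r => iSup_mono fun hr => ?_
  have hle : ∀ y, ENNReal.ofReal (|φ y| ^ p) ≤ ENNReal.ofReal (|ψ y| ^ p) := fun y =>
    ENNReal.ofReal_le_ofReal (Real.rpow_le_rpow (abs_nonneg _) (h y) hp.le)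
  exact mul_le_mul_right (ENNReal.rpow_le_rpow (lintegral_mono hle) (by positivity)) _

theorem morreyNorm_const_mul {p q : ℝ} {d : ℕ} (hp : 0 < p) (c : ℝ)
    (φ : EuclideanSpace ℝ (Fin d) → ℝ) :
    morreyNorm p q d (fun x => c * φ x) = ENNReal.ofReal |c| * morreyNorm p q d φ := by
  simp only [morreyNorm, ENNReal.mul_iSup]
  refine iSup_congr fun a => iSup_congr fun r => iSup_congr fun hr => ?_
  have : ∀ y, ENNReal.ofReal (|c * φ y| ^ p)
      = ENNReal.ofReal (|c| ^ p) * ENNReal.ofReal (|φ y| ^ p) := fun y => by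
    rw [abs_mul, Real.mul_rpow (abs_nonneg _) (abs_nonneg _), ENNReal.ofReal_mul (by positivity)]
  simp only [this]
  rw [lintegral_const_mul' _ _ ENNReal.ofReal_ne_top, ENNReal.mul_rpow_of_nonneg _ _ (by positivity),
    ← ENNReal.ofReal_rpow_of_nonneg (abs_nonneg c) hp.le, ← ENNReal.rpow_mul,
    mul_one_div_cancel hp.ne', ENNReal.rpow_one, mul_left_comm]

theorem setLIntegral_ball_comp_smul {d : ℕ} {t : ℝ} (ht : 0 < t)
    (F : EuclideanSpace ℝ (Fin d) → ℝ≥0∞) (a : EuclideanSpace ℝ (Fin d)) (r : ℝ) :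
    ∫⁻ y in Metric.ball a r, F (t • y)
      = (ENNReal.ofReal t ^ d)⁻¹ * ∫⁻ y in Metric.ball (t • a) (t * r), F y := by
  have he : MeasurableEmbedding (fun y : EuclideanSpace ℝ (Fin d) => t • y) :=
    (Homeomorph.smulOfNeZero t ht.ne').measurableEmbedding
  have hpre : (fun y : EuclideanSpace ℝ (Fin d) => t • y) ⁻¹' Metric.ball (t • a) (t * r)
      = Metric.ball a r := by
    ext y
    simp [dist_smul₀, abs_of_pos ht, ht]
  have hmap := Measure.map_addHaar_smul (volume : Measure (EuclideanSpace ℝ (Fin d))) ht.ne'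
  rw [← hpre, ← he.lintegral_map, ← he.restrict_map, hmap, Measure.restrict_smul,
    lintegral_smul_measure, smul_eq_mul]
  congr 1
  rw [finrank_euclideanSpace_fin, abs_of_pos (by positivity), ENNReal.ofReal_inv_of_pos (by positivity),
    ENNReal.ofReal_pow ht.le]

/-- The Morrey norm does not increase under the dilations `φ ↦ φ (t • ·)`, suitably normalized. -/
theorem morreyNorm_dilation_le {p q : ℝ} {d : ℕ} (hp : 0 < p) {t : ℝ} (ht : 0 < t)
    (φ : EuclideanSpace ℝ (Fin d) → ℝ) :
    morreyNorm p q d (fun x => t ^ ((d : ℝ) / q) * φ (t • x)) ≤ morreyNorm p q d φ := by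
  rw [morreyNorm_const_mul hp _ (fun x => φ (t • x)), abs_of_pos (by positivity)]
  simp only [morreyNorm, ENNReal.mul_iSup]
  refine iSup_le fun a => iSup_le fun r => iSup_le fun hr => ?_
  refine le_iSup_of_le (t • a) (le_iSup_of_le (t * r) (le_iSup_of_le (by positivity) ?_))
  apply le_of_eq
  have hT0 : ENNReal.ofReal t ≠ 0 := by simpa using ht
  have hTt : ENNReal.ofReal t ≠ ∞ := ENNReal.ofReal_ne_top
  have hvol : volume (Metric.ball (t • a) (t * r))
      = ENNReal.ofReal t ^ d * volume (Metric.ball a r) := by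
    rw [Measure.addHaar_ball_mul_of_pos _ _ ht, finrank_euclideanSpace_fin,
      ENNReal.ofReal_pow ht.le, Measure.addHaar_ball_center volume a]
  rw [setLIntegral_ball_comp_smul ht (fun y => ENNReal.ofReal (|φ y| ^ p)), hvol,
    ENNReal.mul_rpow_of_nonneg _ _ (by positivity),
    ENNReal.mul_rpow_of_ne_top (ENNReal.pow_ne_top hTt) measure_ball_lt_top.ne,
    ← ENNReal.ofReal_rpow_of_pos ht, ← ENNReal.rpow_natCast, ← ENNReal.rpow_neg,
    ← ENNReal.rpow_mul, ← ENNReal.rpow_mul]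
  have : ENNReal.ofReal t ^ ((d : ℝ) * (1 / q - 1 / p))
      = ENNReal.ofReal t ^ ((d : ℝ) / q) * ENNReal.ofReal t ^ (-(d : ℝ) * (1 / p)) := by
    rw [← ENNReal.rpow_add _ _ hT0 hTt]
    congr 1
    ring
  rw [this]
  ring

theorem rpow_mul_norm_smul_rpow {E : Type*} [NormedAddCommGroup E] [NormedSpace ℝ E]
    {t : ℝ} (ht : 0 < t) (s : ℝ) (x : E) : t ^ s * ‖t • x‖ ^ (-s) = ‖x‖ ^ (-s) := by
  rw [norm_smul, Real.norm_of_nonneg ht.le, Real.mul_rpow ht.le (norm_nonneg _), ← mul_assoc,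
    ← Real.rpow_add ht]
  simp

open Filter in
theorem morreyNorm_norm_rpow_le {p q : ℝ} {d : ℕ} (hp : 0 < p)
    {ψ : EuclideanSpace ℝ (Fin d) → ℝ} (hψ : Measurable ψ) {t : ℕ → ℝ} (ht : ∀ n, 0 < t n)
    (h : ∀ x, ∀ᶠ n in atTop, ψ (t n • x) = ‖t n • x‖ ^ (-((d : ℝ) / q))) :
    morreyNorm p q d (fun x => ‖x‖ ^ (-((d : ℝ) / q))) ≤ morreyNorm p q d ψ := by
  refine morreyNorm_le_of_eventually_eq hp
    (u := fun n x => t n ^ ((d : ℝ) / q) * ψ (t n • x)) (fun n => ?_) (fun x => ?_)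
    (fun n => morreyNorm_dilation_le hp (ht n) ψ)
  · exact (hψ.comp (measurable_const_smul (t n))).const_mul _
  · filter_upwards [h x] with n hn
    rw [hn, rpow_mul_norm_smul_rpow (ht n)]

open Filter in
/-- For `1 ≤ p < q < ∞`, `d ≥ 1`, `f(x) = |x|^(-d/q)`, `g = χ_(0,1)(|x|) f`,
`k = -f + 2g`, one has `‖f+k‖² + ‖f-k‖² = 4(‖f‖² + ‖k‖²)` in Morrey norm. -/
theorem morreyNorm_parallelogram_max (p q : ℝ) (d : ℕ) (hp : 1 ≤ p) (hpq : p < q) (hd : 1 ≤ d)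
    (f g k : EuclideanSpace ℝ (Fin d) → ℝ)
    (hf : f = fun x => ‖x‖ ^ (-(d : ℝ) / q))
    (hg : g = fun x => if 0 < ‖x‖ ∧ ‖x‖ < 1 then f x else 0)
    (hk : k = -f + (2 : ℝ) • g) :
    (morreyNorm p q d (f + k)) ^ 2 + (morreyNorm p q d (f - k)) ^ 2 =
      4 * ((morreyNorm p q d f) ^ 2 + (morreyNorm p q d k) ^ 2) := by
  have hp0 : 0 < p := by linarith
  have hs : 0 < (d : ℝ) / q := by
    have : (0 : ℝ) < d := by exact_mod_cast hd
    have : 0 < q := by linarith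
    positivity
  rw [neg_div] at hf
  have hf0 : f 0 = 0 := by simp [hf, Real.zero_rpow (neg_ne_zero.2 hs.ne')]
  have hfm : Measurable f := by rw [hf]; fun_prop
  have hgm : Measurable g := by
    rw [hg]
    refine Measurable.ite ?_ hfm measurable_const
    exact (measurableSet_lt measurable_const measurable_norm).inter
      (measurableSet_lt measurable_norm measurable_const)
  have hgcase : ∀ x, g x = f x ∨ g x = 0 := fun x => by
    rw [hg]; dsimp only; split_ifs <;> simp
  have hG : morreyNorm p q d g = morreyNorm p q d f := by
    apply le_antisymm
    · exact morreyNorm_mono hp0 fun x => by rcases hgcase x with h | h <;> simp [h]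
    · have := morreyNorm_norm_rpow_le (q := q) hp0 hgm (t := fun n : ℕ => 1 / ((n : ℝ) + 1))
        (fun n => by positivity) ?_
      · rwa [← hf] at this
      intro x
      have hlim : Tendsto (fun n : ℕ => 1 / ((n : ℝ) + 1) * ‖x‖) atTop (nhds (0 * ‖x‖)) :=
        tendsto_one_div_add_atTop_nhds_zero_nat.mul_const _
      rw [zero_mul] at hlim
      filter_upwards [hlim.eventually_lt_const one_pos] with n hn
      rw [← congrFun hf]
      have hpos : (0 : ℝ) < 1 / ((n : ℝ) + 1) := by positivity
      rcases eq_or_ne x 0 with rfl | hx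
      · simp [hg, hf0]
      · have h1 : ‖(1 / ((n : ℝ) + 1)) • x‖ < 1 := by
          rwa [norm_smul, Real.norm_of_nonneg hpos.le]
        have h2 : 0 < ‖(1 / ((n : ℝ) + 1)) • x‖ :=
          norm_pos_iff.2 (smul_ne_zero hpos.ne' hx)
        rw [hg]
        exact if_pos ⟨h2, h1⟩
  have hH : morreyNorm p q d (f - g) = morreyNorm p q d f := by
    apply le_antisymm
    · exact morreyNorm_mono hp0 fun x => by rcases hgcase x with h | h <;> simp [h]
    · have := morreyNorm_norm_rpow_le (q := q) hp0 (hfm.sub hgm) (t := fun n : ℕ => (n : ℝ) + 1)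
        (fun n => by positivity) ?_
      · rwa [← hf] at this
      intro x
      rcases eq_or_ne x 0 with rfl | hx
      · simp [hg, hf0, Real.zero_rpow (neg_ne_zero.2 hs.ne')]
      · have hlim : Tendsto (fun n : ℕ => ((n : ℝ) + 1) * ‖x‖) atTop atTop :=
          (tendsto_natCast_atTop_atTop.atTop_add tendsto_const_nhds).atTop_mul_const
            (norm_pos_iff.2 hx)
        filter_upwards [hlim.eventually_ge_atTop 1] with n hn
        have h1 : 1 ≤ ‖((n : ℝ) + 1) • x‖ := by
          rwa [norm_smul, Real.norm_of_nonneg (by positivity)]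
        rw [← congrFun hf]
        have : g (((n : ℝ) + 1) • x) = 0 := by
          rw [hg]
          exact if_neg fun h => absurd h.2 (not_lt.2 h1)
        simp [this]
  have hK : morreyNorm p q d k = morreyNorm p q d f := by
    have : ∀ x, |k x| = |f x| := fun x => by
      rcases hgcase x with h | h
      · congr 1
        simp only [hk, Pi.add_apply, Pi.neg_apply, Pi.smul_apply, smul_eq_mul, h]
        ring
      · simp [hk, h]
    exact le_antisymm (morreyNorm_mono hp0 fun x => (this x).le)
      (morreyNorm_mono hp0 fun x => (this x).ge)
  have hadd : f + k = fun x => 2 * g x := by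
    ext x; simp [hk]
  have hsub : f - k = fun x => 2 * (f - g) x := by
    ext x
    simp only [hk, Pi.add_apply, Pi.neg_apply, Pi.smul_apply, Pi.sub_apply, smul_eq_mul]
    ring
  rw [hadd, hsub, morreyNorm_const_mul hp0, morreyNorm_const_mul hp0, hG, hH, hK]
  simp only [abs_two, ENNReal.ofReal_ofNat]
  ring
end

section
/- Let 1 ≤ p < q < ∞, and let n ∈ ℤ be an even positive number with n > 2^{q/(q−p)} − 1 (equivalently, (n+1)^{1/q − 1/p} < 2^{−1/p}). Define x : ℤ → ℝ by x_0 = x_n = 1 and x_k = 0 for k ∉ {0, n}, and y : ℤ → ℝ by y_0 = 1, y_n = −1, and y_k = 0 for k ∉ {0, n}. Then ‖x‖_{ℓ^p_q} = 1 and ‖y‖_{ℓ^p_q} = 1. -/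
open MeasureTheory
open scoped ENNReal

/-- The discrete Morrey norm `‖x‖_{ℓ^p_q}` of `x : ℤ → ℝ` (dimension `d = 1`):
the supremum over `m ∈ ℤ` and `N ∈ ℕ` of
`|S_{m,N}|^(1/q - 1/p) (∑_{k ∈ S_{m,N}} |x k|^p)^(1/p)`, where
`S_{m,N} = {k : |k - m| ≤ N}` has cardinality `2N+1`. -/
noncomputable def discreteMorreyNorm₁ (p q : ℝ) (x : ℤ → ℝ) : ℝ≥0∞ :=
  ⨆ (m : ℤ) (N : ℕ),
    ((2 * N + 1 : ℕ) : ℝ≥0∞) ^ ((1:ℝ)/q - 1/p) *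
      (∑ k ∈ Finset.Icc (m - (N:ℤ)) (m + (N:ℤ)), ENNReal.ofReal (|x k| ^ p)) ^ ((1:ℝ)/p)

/-- If `2 ^ (q / (q - p)) ≤ a`, then `2 ^ (1 / p) ≤ a ^ (1 / p - 1 / q)`. -/
lemma two_rpow_one_div_le_rpow {p q : ℝ} (hp : 0 < p) (hpq : p < q) {a : ℕ}
    (ha : (2 : ℝ) ^ (q / (q - p)) ≤ a) :
    (2 : ℝ≥0∞) ^ (1 / p) ≤ (a : ℝ≥0∞) ^ (1 / p - 1 / q) := by
  have hq : 0 < q := hp.trans hpq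
  have hs : 0 ≤ 1 / p - 1 / q := sub_nonneg.2 (one_div_le_one_div_of_le hp hpq.le)
  have hexp : 1 / p = q / (q - p) * (1 / p - 1 / q) := by
    have : q - p ≠ 0 := (sub_pos.2 hpq).ne'
    field_simp
  have ha' : (2 : ℝ≥0∞) ^ (q / (q - p)) ≤ a := by
    have := ENNReal.ofReal_le_ofReal ha
    rwa [← ENNReal.ofReal_rpow_of_pos two_pos, ENNReal.ofReal_natCast,
      ENNReal.ofReal_ofNat] at this
  calc (2 : ℝ≥0∞) ^ (1 / p) = ((2 : ℝ≥0∞) ^ (q / (q - p))) ^ (1 / p - 1 / q) := by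
        rw [← ENNReal.rpow_mul, ← hexp]
    _ ≤ _ := ENNReal.rpow_le_rpow ha' hs

/-- A sequence of modulus one on `{0, n}` and zero elsewhere has discrete Morrey norm `1`,
provided `n + 1 > 2 ^ (q / (q - p))`. -/
lemma discreteMorreyNorm₁_eq_one_of_abs_eq {p q : ℝ} (hp : 0 < p) (hpq : p < q) {n : ℤ}
    (hn : (2 : ℝ) ^ (q / (q - p)) - 1 < (n : ℝ)) {z : ℤ → ℝ}
    (hz : ∀ k, |z k| = if k = 0 ∨ k = n then 1 else 0) :
    discreteMorreyNorm₁ p q z = 1 := by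
  have hs : 0 ≤ 1 / p - 1 / q := sub_nonneg.2 (one_div_le_one_div_of_le hp hpq.le)
  have hterm : ∀ k, ENNReal.ofReal (|z k| ^ p) = if k ∈ ({0, n} : Finset ℤ) then 1 else 0 := by
    intro k
    rw [hz]
    by_cases h : k = 0 ∨ k = n <;> simp [h, hp.ne']
  have hsum : ∀ s : Finset ℤ, ∑ k ∈ s, ENNReal.ofReal (|z k| ^ p) =
      ((s ∩ {0, n}).card : ℝ≥0∞) := by
    intro s
    simp only [hterm, Finset.sum_ite_mem, Finset.sum_const, nsmul_eq_mul, mul_one]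
  apply le_antisymm
  · refine iSup₂_le fun m N => ?_
    rw [hsum, ← neg_sub, ENNReal.rpow_neg, mul_comm, ← div_eq_mul_inv]
    refine ENNReal.div_le_of_le_mul ?_
    rw [one_mul]
    by_cases h : (0 : ℤ) ∈ Finset.Icc (m - (N : ℤ)) (m + N) ∧ n ∈ Finset.Icc (m - (N : ℤ)) (m + N)
    · have hnN : n ≤ 2 * N := by
        simp only [Finset.mem_Icc] at h
        omega
      have ha : (2 : ℝ) ^ (q / (q - p)) ≤ ((2 * N + 1 : ℕ) : ℝ) := by
        have : (n : ℝ) ≤ 2 * N := by exact_mod_cast hnN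
        push_cast
        linarith
      refine le_trans (ENNReal.rpow_le_rpow ?_ (by positivity)) (two_rpow_one_div_le_rpow hp hpq ha)
      exact_mod_cast (Finset.card_le_card Finset.inter_subset_right).trans Finset.card_le_two
    · have hcard : (Finset.Icc (m - (N : ℤ)) (m + N) ∩ {0, n}).card ≤ 1 := by
        refine Finset.card_le_one.2 fun a ha b hb => ?_
        simp only [Finset.mem_inter, Finset.mem_insert, Finset.mem_singleton] at ha hb
        grind
      calc _ ≤ (1 : ℝ≥0∞) ^ (1 / p) :=
            ENNReal.rpow_le_rpow (by exact_mod_cast hcard) (by positivity)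
        _ = (1 : ℝ≥0∞) ^ (1 / p - 1 / q) := by rw [ENNReal.one_rpow, ENNReal.one_rpow]
        _ ≤ _ := ENNReal.rpow_le_rpow (by exact_mod_cast Nat.le_add_left 1 _) hs
  · refine le_iSup₂_of_le 0 0 ?_
    simp [hz, hp.ne']

/-- For `1 ≤ p < q < ∞` and an even positive `n ∈ ℤ` with `n > 2^(q/(q-p)) - 1`,
the sequences `x = e₀ + eₙ` and `y = e₀ - eₙ` have discrete Morrey norm `1`. -/
theorem discreteMorreyNorm_xy_eq_one (p q : ℝ) (hp : 1 ≤ p) (hpq : p < q)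
    (n : ℤ) (hne : Even n) (hn0 : 0 < n) (hn : (2 : ℝ) ^ (q / (q - p)) - 1 < (n : ℝ))
    (x y : ℤ → ℝ)
    (hx : x = fun k => if k = 0 ∨ k = n then 1 else 0)
    (hy : y = fun k => if k = 0 then 1 else if k = n then -1 else 0) :
    discreteMorreyNorm₁ p q x = 1 ∧ discreteMorreyNorm₁ p q y = 1 := by
  have hp0 : 0 < p := one_pos.trans_le hp
  constructor
  · refine discreteMorreyNorm₁_eq_one_of_abs_eq hp0 hpq hn fun k => ?_
    rw [hx]
    dsimp only
    split_ifs <;> simp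
  · refine discreteMorreyNorm₁_eq_one_of_abs_eq hp0 hpq hn fun k => ?_
    rw [hy]
    dsimp only
    split_ifs <;> simp_all
end

section
/- Let 1 ≤ p < q < ∞, and let n ∈ ℤ be an even positive number with n > 2^{q/(q−p)} − 1. Define x : ℤ → ℝ by x_0 = x_n = 1 and x_k = 0 for k ∉ {0, n}, and y : ℤ → ℝ by y_0 = 1, y_n = −1, and y_k = 0 for k ∉ {0, n}. Then ‖x+y‖_{ℓ^p_q} = 2 and ‖x−y‖_{ℓ^p_q} = 2, and consequently (‖x+y‖²_{ℓ^p_q} + ‖x−y‖²_{ℓ^p_q}) / (2(‖x‖²_{ℓ^p_q} + ‖y‖²_{ℓ^p_q})) = 2. -/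
open MeasureTheory
open scoped ENNReal

/-- The one-point windows bound the Morrey norm from below by every entry. -/
theorem ofReal_abs_le_discreteMorreyNorm₁ {p : ℝ} (hp : 0 < p) (q : ℝ) (z : ℤ → ℝ) (m : ℤ) :
    ENNReal.ofReal |z m| ≤ discreteMorreyNorm₁ p q z := by
  refine le_trans (le_of_eq ?_) (le_iSup₂ m 0)
  simp [← ENNReal.rpow_mul, hp.ne', ← ENNReal.ofReal_rpow_of_nonneg (abs_nonneg _) hp.le]

/-- If `z` is supported in `S` and bounded by `c`, and each window contains so few points of `S`
that its normalised counting term is at most `1`, then the Morrey norm of `z` is at most `c`. -/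
theorem discreteMorreyNorm₁_le {p q c : ℝ} (hp : 0 < p) {z : ℤ → ℝ} {S : Finset ℤ}
    (hS : ∀ k ∉ S, z k = 0) (hc : ∀ k, |z k| ≤ c)
    (h : ∀ (m : ℤ) (N : ℕ), ((2 * N + 1 : ℕ) : ℝ≥0∞) ^ ((1:ℝ)/q - 1/p) *
      ((Finset.Icc (m - (N:ℤ)) (m + (N:ℤ)) ∩ S).card : ℝ≥0∞) ^ ((1:ℝ)/p) ≤ 1) :
    discreteMorreyNorm₁ p q z ≤ ENNReal.ofReal c := by
  have hc0 : 0 ≤ c := (abs_nonneg _).trans (hc 0)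
  refine iSup₂_le fun m N => ?_
  set F := Finset.Icc (m - (N:ℤ)) (m + (N:ℤ)) with hF
  have hsum : ∑ k ∈ F, ENNReal.ofReal (|z k| ^ p) ≤
      ((F ∩ S).card : ℝ≥0∞) * ENNReal.ofReal c ^ p := by
    rw [← Finset.sum_subset (Finset.inter_subset_left (s₁ := F) (s₂ := S)), ← nsmul_eq_mul]
    · refine Finset.sum_le_card_nsmul _ _ _ fun k _ => ?_
      rw [← ENNReal.ofReal_rpow_of_nonneg (abs_nonneg _) hp.le]
      exact ENNReal.rpow_le_rpow (ENNReal.ofReal_le_ofReal (hc k)) hp.le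
    · intro k hk hkS
      have : k ∉ S := fun h' => hkS (Finset.mem_inter.2 ⟨hk, h'⟩)
      simp [hS k this, Real.zero_rpow hp.ne']
  calc _ ≤ ((2 * N + 1 : ℕ) : ℝ≥0∞) ^ ((1:ℝ)/q - 1/p) *
        (((F ∩ S).card : ℝ≥0∞) * ENNReal.ofReal c ^ p) ^ ((1:ℝ)/p) := by gcongr
    _ = (((2 * N + 1 : ℕ) : ℝ≥0∞) ^ ((1:ℝ)/q - 1/p) *
        ((F ∩ S).card : ℝ≥0∞) ^ ((1:ℝ)/p)) * ENNReal.ofReal c := by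
      rw [ENNReal.mul_rpow_of_nonneg _ _ (by positivity), ← ENNReal.rpow_mul,
        mul_one_div_cancel hp.ne', ENNReal.rpow_one, mul_assoc]
    _ ≤ 1 * ENNReal.ofReal c := by gcongr; exact h m N
    _ = _ := one_mul _

/-- The normalised counting term is at most `1` when at most one point is counted. -/
theorem rpow_mul_card_rpow_le_one {p q : ℝ} (hp : 0 < p) (hpq : p ≤ q) (N : ℕ) {r : ℕ}
    (hr : r ≤ 1) :
    ((2 * N + 1 : ℕ) : ℝ≥0∞) ^ ((1:ℝ)/q - 1/p) * (r : ℝ≥0∞) ^ ((1:ℝ)/p) ≤ 1 := by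
  have h1 : (1:ℝ≥0∞) ≤ ((2 * N + 1 : ℕ) : ℝ≥0∞) := by exact_mod_cast (by omega)
  have h2 : (1:ℝ)/q - 1/p ≤ 0 := sub_nonpos.2 (one_div_le_one_div_of_le hp hpq)
  have h3 : ((2 * N + 1 : ℕ) : ℝ≥0∞) ^ ((1:ℝ)/q - 1/p) ≤ 1 := by
    simpa using ENNReal.rpow_le_rpow_of_exponent_le h1 h2
  have h4 : (r : ℝ≥0∞) ^ ((1:ℝ)/p) ≤ 1 :=
    ENNReal.rpow_le_one (by exact_mod_cast hr) (by positivity)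
  exact mul_le_one' h3 h4

/-- The normalised counting term of two points is at most `1` for a window of cardinality at
least `2 ^ (q / (q - p))`. -/
theorem rpow_mul_two_rpow_le_one {p q : ℝ} (hp : 0 < p) (hpq : p < q) {L : ℕ}
    (hL : (2 : ℝ) ^ (q / (q - p)) ≤ L) :
    (L : ℝ≥0∞) ^ ((1:ℝ)/q - 1/p) * (2 : ℝ≥0∞) ^ ((1:ℝ)/p) ≤ 1 := by
  have hq : 0 < q := hp.trans hpq
  have hd : 0 < q - p := sub_pos.2 hpq
  have hL0 : (0:ℝ) < L := lt_of_lt_of_le (by positivity) hL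
  have key : (L : ℝ) ^ ((1:ℝ)/q - 1/p) * (2 : ℝ) ^ ((1:ℝ)/p) ≤ 1 := by
    have h2 : (1:ℝ)/q - 1/p ≤ 0 := sub_nonpos.2 (one_div_le_one_div_of_le hp hpq.le)
    calc _ ≤ ((2 : ℝ) ^ (q / (q - p))) ^ ((1:ℝ)/q - 1/p) * (2 : ℝ) ^ ((1:ℝ)/p) := by
          gcongr ?_ * _
          exact Real.rpow_le_rpow_of_nonpos (by positivity) hL h2
      _ = 1 := by
          rw [← Real.rpow_mul (by norm_num), ← Real.rpow_add (by norm_num)]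
          have : q / (q - p) * ((1:ℝ)/q - 1/p) + 1/p = 0 := by field_simp; ring
          rw [this, Real.rpow_zero]
  have h := ENNReal.ofReal_le_ofReal key
  rw [ENNReal.ofReal_mul (by positivity), ← ENNReal.ofReal_rpow_of_pos hL0,
    ← ENNReal.ofReal_rpow_of_pos (by norm_num)] at h
  simpa using h

/-- A sequence supported at one point has Morrey norm equal to the modulus of its entry there. -/
theorem discreteMorreyNorm₁_of_support_singleton {p q : ℝ} (hp : 0 < p) (hpq : p ≤ q)
    {z : ℤ → ℝ} {a : ℤ} (hz : ∀ k, k ≠ a → z k = 0) :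
    discreteMorreyNorm₁ p q z = ENNReal.ofReal |z a| := by
  refine le_antisymm ?_ (ofReal_abs_le_discreteMorreyNorm₁ hp q z a)
  refine discreteMorreyNorm₁_le (S := {a}) hp (by simpa using hz) (fun k => ?_) fun m N =>
    rpow_mul_card_rpow_le_one hp hpq N
      ((Finset.card_le_card Finset.inter_subset_right).trans_eq (Finset.card_singleton a))
  by_cases hk : k = a
  · rw [hk]
  · simp [hz k hk]

/-- A sequence of modulus one at two distant points `0` and `n` and zero elsewhere has Morrey
norm `1`. -/
theorem discreteMorreyNorm₁_of_support_pair {p q : ℝ} (hp : 0 < p) (hpq : p < q) {n : ℤ}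
    (hn0 : 0 < n) (hn : (2 : ℝ) ^ (q / (q - p)) - 1 ≤ (n : ℝ)) {z : ℤ → ℝ} (hz0 : |z 0| = 1)
    (hzn : |z n| = 1) (hz : ∀ k, k ≠ 0 → k ≠ n → z k = 0) :
    discreteMorreyNorm₁ p q z = 1 := by
  refine le_antisymm ?_ (by simpa [hz0] using ofReal_abs_le_discreteMorreyNorm₁ hp q z 0)
  rw [← ENNReal.ofReal_one]
  refine discreteMorreyNorm₁_le (S := {0, n}) hp (fun k hk => ?_) (fun k => ?_) fun m N => ?_
  · simp only [Finset.mem_insert, Finset.mem_singleton, not_or] at hk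
    exact hz k hk.1 hk.2
  · by_cases h0 : k = 0
    · rw [h0, hz0]
    by_cases h1 : k = n
    · rw [h1, hzn]
    simp [hz k h0 h1]
  · set F := Finset.Icc (m - (N:ℤ)) (m + (N:ℤ)) with hF
    have hcard : ({0, n} : Finset ℤ).card = 2 := Finset.card_pair hn0.ne
    have hle : (F ∩ {0, n}).card ≤ 2 := hcard ▸ Finset.card_le_card Finset.inter_subset_right
    rcases Nat.lt_or_ge (F ∩ {0, n}).card 2 with h | h
    · exact rpow_mul_card_rpow_le_one hp hpq.le N (by omega)
    · have heq : F ∩ {0, n} = {0, n} :=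
        Finset.eq_of_subset_of_card_le Finset.inter_subset_right (hcard ▸ h)
      have hsub : ({0, n} : Finset ℤ) ⊆ F := Finset.inter_eq_right.1 heq
      have m0 : (0:ℤ) ∈ F := hsub (by simp)
      have mn : n ∈ F := hsub (by simp)
      rw [hF, Finset.mem_Icc] at m0 mn
      have hnN : (n:ℝ) ≤ 2 * N := by exact_mod_cast (by omega : n ≤ 2 * (N:ℤ))
      rw [heq, hcard]
      exact rpow_mul_two_rpow_le_one hp hpq (by push_cast; linarith)

/-- For `1 ≤ p < q < ∞` and an even positive `n ∈ ℤ` with `n > 2^(q/(q-p)) - 1`,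
with `x = e₀ + eₙ` and `y = e₀ - eₙ`, one has `‖x+y‖ = ‖x-y‖ = 2` and the
von Neumann–Jordan quotient of the pair `(x, y)` equals `2`. -/
theorem discreteMorreyNorm_vNJ_quotient (p q : ℝ) (hp : 1 ≤ p) (hpq : p < q)
    (n : ℤ) (hne : Even n) (hn0 : 0 < n) (hn : (2 : ℝ) ^ (q / (q - p)) - 1 < (n : ℝ))
    (x y : ℤ → ℝ)
    (hx : x = fun k => if k = 0 ∨ k = n then 1 else 0)
    (hy : y = fun k => if k = 0 then 1 else if k = n then -1 else 0) :
    discreteMorreyNorm₁ p q (x + y) = 2 ∧ discreteMorreyNorm₁ p q (x - y) = 2 ∧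
    ((discreteMorreyNorm₁ p q (x + y)) ^ 2 + (discreteMorreyNorm₁ p q (x - y)) ^ 2) /
        (2 * ((discreteMorreyNorm₁ p q x) ^ 2 + (discreteMorreyNorm₁ p q y) ^ 2)) = 2 := by
  have hp0 : 0 < p := by linarith
  have hx1 : discreteMorreyNorm₁ p q x = 1 :=
    discreteMorreyNorm₁_of_support_pair hp0 hpq hn0 hn.le (by simp [hx]) (by simp [hx])
      (fun k h0 h1 => by simp [hx, h0, h1])
  have hy1 : discreteMorreyNorm₁ p q y = 1 :=
    discreteMorreyNorm₁_of_support_pair hp0 hpq hn0 hn.le (by simp [hy]) (by simp [hy, hn0.ne'])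
      (fun k h0 h1 => by simp [hy, h0, h1])
  have hadd : discreteMorreyNorm₁ p q (x + y) = 2 := by
    rw [discreteMorreyNorm₁_of_support_singleton (a := 0) hp0 hpq.le]
    · norm_num [hx, hy]
    · intro k hk
      by_cases h : k = n <;> simp [hx, hy, hk, h, hn0.ne']
  have hsub : discreteMorreyNorm₁ p q (x - y) = 2 := by
    rw [discreteMorreyNorm₁_of_support_singleton (a := n) hp0 hpq.le]
    · norm_num [hx, hy, hn0.ne']
    · intro k hk
      by_cases h : k = 0 <;> simp [hx, hy, hk, h]
  refine ⟨hadd, hsub, ?_⟩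
  rw [hadd, hsub, hx1, hy1]
  symm
  rw [ENNReal.eq_div_iff] <;> norm_num
end

section
/- Let 1 ≤ p < q < ∞ and d ≥ 1, and let n ∈ ℤ be an even positive number with n > 2^{q/(d(q−p))} − 1 (equivalently, (n+1)^{d(1/q − 1/p)} < 2^{−1/p}). Define x : ℤ^d → ℝ by x(k) = 1 if k = (0,0,…,0) or k = (n,0,…,0) and x(k) = 0 otherwise, and y : ℤ^d → ℝ by y(k) = 1 if k = (0,0,…,0), y(k) = −1 if k = (n,0,…,0), and y(k) = 0 otherwise. Then ‖x‖_{ℓ^p_q} = ‖y‖_{ℓ^p_q} = 1 and ‖x+y‖_{ℓ^p_q} = ‖x−y‖_{ℓ^p_q} = 2. -/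
open MeasureTheory
open scoped ENNReal Classical

/-- The discrete Morrey norm `‖x‖_{ℓ^p_q}` of `x : ℤ^d → ℝ`:
the supremum over `m ∈ ℤ^d` and `N ∈ ℕ` of
`|S_{m,N}|^(1/q - 1/p) (∑_{k ∈ S_{m,N}} |x k|^p)^(1/p)`, where
`S_{m,N} = {k : ‖k - m‖_∞ ≤ N}` has cardinality `(2N+1)^d`. -/
noncomputable def discreteMorreyNorm (p q : ℝ) (d : ℕ) (x : (Fin d → ℤ) → ℝ) : ℝ≥0∞ :=
  ⨆ (m : Fin d → ℤ) (N : ℕ),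
    (((2 * N + 1) ^ d : ℕ) : ℝ≥0∞) ^ ((1:ℝ)/q - 1/p) *
      (∑ k ∈ Fintype.piFinset (fun i => Finset.Icc (m i - (N:ℤ)) (m i + (N:ℤ))),
        ENNReal.ofReal (|x k| ^ p)) ^ ((1:ℝ)/p)

/-- If `1 ≤ p < q` and `n > 2^(q/(d(q-p))) - 1`, a cube of side `2N+1 > n` has volume at least
`2^(q/(q-p))`, written here in terms of the Morrey weight. -/
theorem two_le_card_cube_rpow {p q : ℝ} {d N : ℕ} (hp : 0 < p) (hpq : p < q) (hd : 1 ≤ d) {n : ℤ}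
    (hn : (2 : ℝ) ^ (q / (d * (q - p))) - 1 < (n : ℝ)) (hN : n ≤ 2 * N) :
    (2 : ℝ≥0∞) ≤ (((2 * N + 1) ^ d : ℕ) : ℝ≥0∞) ^ (1 - p / q) := by
  have hq : 0 < q := hp.trans hpq
  have hd' : (0 : ℝ) < d := by exact_mod_cast hd
  have hqp : 0 < q - p := sub_pos.2 hpq
  have hN' : (n : ℝ) ≤ 2 * N := by exact_mod_cast hN
  have hbase : (2 : ℝ) ^ (q / (d * (q - p))) ≤ 2 * N + 1 := by linarith
  have hexp : q / (d * (q - p)) * (d * (1 - p / q)) = 1 := by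
    field_simp
  have hpos : 0 ≤ (d : ℝ) * (1 - p / q) := by
    have : p / q ≤ 1 := (div_le_one hq).2 hpq.le
    exact mul_nonneg hd'.le (by linarith)
  have hreal : (2 : ℝ) ≤ (((2 * N + 1) ^ d : ℕ) : ℝ) ^ (1 - p / q) := by
    calc (2 : ℝ) = ((2 : ℝ) ^ (q / (d * (q - p)))) ^ (d * (1 - p / q)) := by
          rw [← Real.rpow_mul (by norm_num), hexp, Real.rpow_one]
      _ ≤ (2 * N + 1 : ℝ) ^ (d * (1 - p / q)) :=
          Real.rpow_le_rpow (by positivity) hbase hpos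
      _ = (((2 * N + 1) ^ d : ℕ) : ℝ) ^ (1 - p / q) := by
          rw [Real.rpow_mul (by positivity), Real.rpow_natCast]
          push_cast
          rfl
  have h := ENNReal.ofReal_le_ofReal hreal
  rwa [← ENNReal.ofReal_rpow_of_pos (by positivity), ENNReal.ofReal_natCast,
    ENNReal.ofReal_ofNat] at h

/-- A weighted `ℓ^p` sum is bounded by `c` once the number `M` of its terms is small compared
with the volume `A`. -/
theorem rpow_mul_rpow_le_of_le_rpow {p q : ℝ} (hp : 0 < p) {A : ℕ} (hA : A ≠ 0)
    {M : ℝ≥0∞} (hM : M ≤ (A : ℝ≥0∞) ^ (1 - p / q)) (c : ℝ≥0∞) :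
    (A : ℝ≥0∞) ^ ((1 : ℝ) / q - 1 / p) * (M * c ^ p) ^ ((1 : ℝ) / p) ≤ c := by
  have hA0 : (A : ℝ≥0∞) ≠ 0 := by exact_mod_cast hA
  calc (A : ℝ≥0∞) ^ ((1 : ℝ) / q - 1 / p) * (M * c ^ p) ^ ((1 : ℝ) / p)
      ≤ (A : ℝ≥0∞) ^ ((1 : ℝ) / q - 1 / p) *
          ((A : ℝ≥0∞) ^ (1 - p / q) * c ^ p) ^ ((1 : ℝ) / p) := by gcongr
    _ = (A : ℝ≥0∞) ^ ((1 : ℝ) / q - 1 / p + (1 - p / q) * (1 / p)) * c := by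
        rw [ENNReal.mul_rpow_of_nonneg _ _ (by positivity), ← ENNReal.rpow_mul,
          ← ENNReal.rpow_mul, mul_one_div_cancel hp.ne', ENNReal.rpow_one, ← mul_assoc,
          ENNReal.rpow_add _ _ hA0 (ENNReal.natCast_ne_top A)]
    _ = c := by
        have : (1 : ℝ) / q - 1 / p + (1 - p / q) * (1 / p) = 0 := by
          field_simp
          ring
        rw [this, ENNReal.rpow_zero, one_mul]

/-- The discrete Morrey norm of a sequence supported on two points at large distance is its
sup norm. -/
theorem discreteMorreyNorm_eq_of_support_pair {p q : ℝ} {d : ℕ} (hp : 0 < p) (hpq : p < q)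
    (hd : 1 ≤ d) {n : ℤ} (hn : (2 : ℝ) ^ (q / (d * (q - p))) - 1 < (n : ℝ))
    {a b : Fin d → ℤ} {i : Fin d} (hab : a i + n ≤ b i) {c : ℝ} {f : (Fin d → ℤ) → ℝ}
    (hf : ∀ k, |f k| ≤ c) (hsupp : ∀ k, f k ≠ 0 → k = a ∨ k = b)
    {k₀ : Fin d → ℤ} (hk₀ : |f k₀| = c) :
    discreteMorreyNorm p q d f = ENNReal.ofReal c := by
  have hq : 0 < q := hp.trans hpq
  have hc : 0 ≤ c := hk₀ ▸ abs_nonneg _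
  apply le_antisymm
  · refine iSup₂_le fun m N => ?_
    set B := Fintype.piFinset (fun i => Finset.Icc (m i - (N : ℤ)) (m i + (N : ℤ)))
    have hsum : ∑ k ∈ B, ENNReal.ofReal (|f k| ^ p) ≤
        ((B ∩ {a, b}).card : ℝ≥0∞) * ENNReal.ofReal c ^ p := by
      rw [← Finset.sum_subset (s₁ := B ∩ {a, b}) Finset.inter_subset_left]
      · rw [← nsmul_eq_mul]
        refine Finset.sum_le_card_nsmul _ _ _ fun k _ => ?_
        rw [ENNReal.ofReal_rpow_of_nonneg hc hp.le]
        exact ENNReal.ofReal_le_ofReal (Real.rpow_le_rpow (abs_nonneg _) (hf k) hp.le)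
      · intro k hkB hk
        have : f k = 0 := by
          by_contra h
          exact hk (Finset.mem_inter.2 ⟨hkB, by simpa using hsupp k h⟩)
        simp [this, Real.zero_rpow hp.ne']
    have hcard : ((B ∩ {a, b}).card : ℝ≥0∞) ≤
        (((2 * N + 1) ^ d : ℕ) : ℝ≥0∞) ^ (1 - p / q) := by
      by_cases h : a ∈ B ∧ b ∈ B
      · have hai := Finset.mem_Icc.1 (Fintype.mem_piFinset.1 h.1 i)
        have hbi := Finset.mem_Icc.1 (Fintype.mem_piFinset.1 h.2 i)
        refine le_trans ?_ (two_le_card_cube_rpow hp hpq hd hn (N := N) (by linarith))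
        exact_mod_cast (Finset.card_le_card Finset.inter_subset_right).trans Finset.card_le_two
      · have h1 : (B ∩ {a, b}).card ≤ 1 := by
          refine Finset.card_le_one.2 fun k hk l hl => ?_
          simp only [Finset.mem_inter, Finset.mem_insert, Finset.mem_singleton] at hk hl
          grind
        have hexp : 0 ≤ 1 - p / q := sub_nonneg.2 ((div_le_one hq).2 hpq.le)
        calc ((B ∩ {a, b}).card : ℝ≥0∞) ≤ 1 := by exact_mod_cast h1
          _ = 1 ^ (1 - p / q) := (ENNReal.one_rpow _).symm
          _ ≤ _ := ENNReal.rpow_le_rpow (by exact_mod_cast Nat.one_le_pow _ _ (by omega)) hexp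
    calc _ ≤ (((2 * N + 1) ^ d : ℕ) : ℝ≥0∞) ^ ((1 : ℝ) / q - 1 / p) *
          (((B ∩ {a, b}).card : ℝ≥0∞) * ENNReal.ofReal c ^ p) ^ ((1 : ℝ) / p) := by gcongr
      _ ≤ _ := rpow_mul_rpow_le_of_le_rpow hp (by positivity) hcard _
  · refine le_trans (le_of_eq ?_) (le_iSup₂ k₀ 0)
    have : Fintype.piFinset (fun i => Finset.Icc (k₀ i - ((0 : ℕ) : ℤ)) (k₀ i + ((0 : ℕ) : ℤ)))
        = {k₀} := by
      simp
    rw [this, Finset.sum_singleton, hk₀, ← ENNReal.ofReal_rpow_of_nonneg hc hp.le,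
      ← ENNReal.rpow_mul, mul_one_div_cancel hp.ne']
    simp

/-- For `1 ≤ p < q < ∞`, `d ≥ 1`, and an even positive `n ∈ ℤ` with
`n > 2^(q/(d(q-p))) - 1`, the sequences `x = e₀ + e_(n,0,…,0)` and `y = e₀ - e_(n,0,…,0)`
satisfy `‖x‖ = ‖y‖ = 1` and `‖x+y‖ = ‖x-y‖ = 2` in the discrete Morrey norm. -/
theorem discreteMorreyNorm_xy_dim_d (p q : ℝ) (d : ℕ) (hp : 1 ≤ p) (hpq : p < q) (hd : 1 ≤ d)
    (n : ℤ) (hne : Even n) (hn0 : 0 < n)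
    (hn : (2 : ℝ) ^ (q / (d * (q - p))) - 1 < (n : ℝ))
    (x y : (Fin d → ℤ) → ℝ)
    (hx : x = fun k => if k = (fun _ => 0 : Fin d → ℤ) ∨
        k = (fun i => if (i : ℕ) = 0 then n else 0 : Fin d → ℤ) then (1 : ℝ) else 0)
    (hy : y = fun k => if k = (fun _ => 0 : Fin d → ℤ) then (1 : ℝ)
      else if k = (fun i => if (i : ℕ) = 0 then n else 0 : Fin d → ℤ) then -1 else 0) :
    discreteMorreyNorm p q d x = 1 ∧ discreteMorreyNorm p q d y = 1 ∧
    discreteMorreyNorm p q d (x + y) = 2 ∧ discreteMorreyNorm p q d (x - y) = 2 := by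
  have hp0 : 0 < p := by linarith
  have hne0 : (fun i => if (i : ℕ) = 0 then n else 0 : Fin d → ℤ) ≠ fun _ => 0 := fun h => by
    have := congrFun h ⟨0, hd⟩
    simp at this
    omega
  have key := @discreteMorreyNorm_eq_of_support_pair p q d hp0 hpq hd n hn (fun _ => 0)
    (fun i => if (i : ℕ) = 0 then n else 0) ⟨0, hd⟩ (by simp)
  generalize (fun i => if (i : ℕ) = 0 then n else 0 : Fin d → ℤ) = b at *
  generalize (fun _ => 0 : Fin d → ℤ) = a at *
  subst hx hy
  refine ⟨?_, ?_, ?_, ?_⟩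
  · rw [← ENNReal.ofReal_one]
    refine key (k₀ := a) (fun k => ?_) (fun k => ?_) ?_ <;> grind
  · rw [← ENNReal.ofReal_one]
    refine key (k₀ := a) (fun k => ?_) (fun k => ?_) ?_ <;> grind
  · rw [← ENNReal.ofReal_ofNat]
    refine key (k₀ := a) (fun k => ?_) (fun k => ?_) ?_ <;> simp only [Pi.add_apply] <;> grind
  · rw [← ENNReal.ofReal_ofNat]
    refine key (k₀ := b) (fun k => ?_) (fun k => ?_) ?_ <;> simp only [Pi.sub_apply] <;> grind
end
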